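/- Let (𝔊,Φ) be a structurally compatible bipermutative cellular automaton of radius 1 on a topological Markov chain 𝔊, and let μ be a shift-invariant probability measure on 𝔊 with complete connections (compatible with 𝔊) and summable decay. Then there exist data (𝔽, τ, n, k, ⊗), with ⊗ a k-block quasigroup operation on 𝔥 = 𝔥(𝔽,τ,n), and a 1-block topological conjugacy φ between (𝔊,Φ) and (𝔥, x ↦ x ⊗ σ_𝔥 x) such that the pushforward μ ∘ φ^{−1} is a shift-invariant probability measure on 𝔥 with complete connections (compatible with 𝔥) and summable decay. -/

import Mathlib

open Filter Topology MeasureTheory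
open scoped ENNReal

namespace CAStmt

/-- The shift map on bi-infinite sequences. -/
def shiftMap {G : Type*} (x : ℤ → G) : ℤ → G := fun n => x (n + 1)

/-- The topological Markov chain determined by the transition set `E`. -/
def TMC {G : Type*} (E : Set (G × G)) : Set (ℤ → G) := {x | ∀ i : ℤ, (x i, x (i + 1)) ∈ E}

/-- The word `w` occurs in some point of `X`. -/
def WordIn {G : Type*} (X : Set (ℤ → G)) {m : ℕ} (w : Fin m → G) : Prop :=
  ∃ x ∈ X, ∃ j : ℤ, ∀ i : Fin m, x (j + ((i : ℕ) : ℤ)) = w i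

/-- Every letter of the alphabet occurs in some point of the TMC. -/
def EveryLetterOccurs {G : Type*} (E : Set (G × G)) : Prop :=
  ∀ g : G, ∃ x ∈ TMC E, ∃ i : ℤ, x i = g

/-- The radius-1 cellular automaton map with local rule `φ`. -/
def CA {G : Type*} (φ : G → G → G) (x : ℤ → G) : ℤ → G := fun j => φ (x j) (x (j + 1))

/-- Structural compatibility of the local rule `φ` with the TMC of `E`. -/
def SC {G : Type*} (E : Set (G × G)) (φ : G → G → G) : Prop :=
  ∀ x ∈ TMC E, ∀ y ∈ TMC E, (fun i => φ (x i) (y i)) ∈ TMC E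

def RightPerm {G : Type*} (φ : G → G → G) : Prop := ∀ a, Function.Bijective (φ a)

def LeftPerm {G : Type*} (φ : G → G → G) : Prop := ∀ b, Function.Bijective (fun a => φ a b)

/-- Irreducibility: any two letters are joined by an allowed word `(u,v₁,…,v_k,w)`, `k ≥ 1`. -/
def IrreducibleTMC {G : Type*} (E : Set (G × G)) : Prop :=
  ∀ u w : G, ∃ x ∈ TMC E, ∃ i j : ℤ, i + 1 < j ∧ x i = u ∧ x j = w

/-- Mixing with mixing constant `q`. -/
def MixingTMCWith {G : Type*} (E : Set (G × G)) (q : ℕ) : Prop :=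
  1 ≤ q ∧ ∀ k : ℕ, q ≤ k → ∀ u w : G,
    ∃ x ∈ TMC E, ∃ i : ℤ, x i = u ∧ x (i + (k : ℤ) + 1) = w

def MixingTMC {G : Type*} (E : Set (G × G)) : Prop := ∃ q, MixingTMCWith E q

/-- `Φ` is `N`-scaling on `X`: `(Φ^N x)₀ = φ(x₀, x_N)`. -/
def NScalingOn {G : Type*} (X : Set (ℤ → G)) (φ : G → G → G) (N : ℕ) : Prop :=
  ∀ x ∈ X, (CA φ)^[N] x 0 = φ (x 0) (x (N : ℤ))

/-- The TMC `𝔥(𝔽,τ,n)` over the alphabet `F × Fin n`. -/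
def hTMC {F : Type*} (τ : Equiv.Perm F) (n : ℕ) : Set (ℤ → F × Fin n) :=
  TMC {p : (F × Fin n) × (F × Fin n) | p.2.1 = τ p.1.1}

/-- `op` is a `k`-block operation (memory 0, anticipation `k-1`) closed on `Λ`. -/
def KBlockOp {A : Type*} (Λ : Set (ℤ → A)) (k : ℕ)
    (op : (ℤ → A) → (ℤ → A) → (ℤ → A)) : Prop :=
  (∀ x ∈ Λ, ∀ y ∈ Λ, op x y ∈ Λ) ∧
  ∃ ρ : (Fin k → A) → (Fin k → A) → A,
    ∀ x ∈ Λ, ∀ y ∈ Λ, ∀ j : ℤ,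
      op x y j = ρ (fun i => x (j + ((i : ℕ) : ℤ))) (fun i => y (j + ((i : ℕ) : ℤ)))

/-- `op` is a quasigroup operation on `Λ`: all translations are bijections of `Λ`. -/
def QuasigroupOp {A : Type*} (Λ : Set (ℤ → A)) (op : (ℤ → A) → (ℤ → A) → (ℤ → A)) : Prop :=
  ∀ z ∈ Λ, Set.BijOn (fun x => op x z) Λ Λ ∧ Set.BijOn (fun y => op z y) Λ Λ

/-- A 1-block topological conjugacy between `(X,Φ)` and `(Y,Ψ)` induced by the letter map `θ`. -/
def OneBlockConjugacy {A B : Type*} (X : Set (ℤ → A)) (Φ : (ℤ → A) → (ℤ → A))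
    (Y : Set (ℤ → B)) (Ψ : (ℤ → B) → (ℤ → B)) (θ : A → B) : Prop :=
  Set.BijOn (fun x => θ ∘ x) X Y ∧ ∀ x ∈ X, θ ∘ (Φ x) = Ψ (θ ∘ x)

/-- `add` is an abelian group operation. -/
def IsAbelianGroupOp {K : Type*} (add : K → K → K) : Prop :=
  (∀ a b c, add (add a b) c = add a (add b c)) ∧ (∀ a b, add a b = add b a) ∧
  ∃ z : K, (∀ a, add z a = a) ∧ ∀ a, ∃ b, add a b = z

/-- The product transition set on `K × B`. -/
def prodE {K B : Type*} (EK : Set (K × K)) (EB : Set (B × B)) : Set ((K × B) × (K × B)) :=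
  {p | (p.1.1, p.2.1) ∈ EK ∧ (p.1.2, p.2.2) ∈ EB}

/-- `φK` is an affine local rule for the abelian group operation `add`. -/
def IsAffineRuleExpl {K : Type*} (add : K → K → K) (φK : K → K → K) : Prop :=
  IsAbelianGroupOp add ∧
  ∃ (η ρc : K → K) (c : K), Function.Bijective η ∧ Function.Bijective ρc ∧
    (∀ a b, η (add a b) = add (η a) (η b)) ∧ (∀ a b, ρc (add a b) = add (ρc a) (ρc b)) ∧
    (∀ a, η (ρc a) = ρc (η a)) ∧
    ∀ a b, φK a b = add (add (η a) (ρc b)) c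

/-- The cylinder on the word `w` at coordinates `0,…,m-1`. -/
def cyl {A : Type*} {m : ℕ} (w : Fin m → A) : Set (ℤ → A) :=
  {x | ∀ i : Fin m, x ((i : ℕ) : ℤ) = w i}

/-- A past: `p i` is the letter at coordinate `-(i+1)`; all transitions allowed. -/
def IsPast {A : Type*} (E : Set (A × A)) (p : ℕ → A) : Prop :=
  ∀ i : ℕ, (p (i + 1), p i) ∈ E

/-- The word `(w_{-m},…,w_{-1})` of the past `p`. -/
def pastWord {A : Type*} (p : ℕ → A) (m : ℕ) : Fin m → A :=
  fun j => p (m - 1 - (j : ℕ))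

/-- `μ` has complete connections (compatible with the TMC of `E`) and summable decay. -/
def CCSD {A : Type*} [MeasurableSpace A] (E : Set (A × A)) (μ : Measure (ℤ → A)) : Prop :=
  ∃ ν : (ℕ → A) → A → ℝ,
    (∀ p, IsPast E p → ∀ a, (p 0, a) ∈ E →
      0 < ν p a ∧
      Tendsto (fun m : ℕ =>
          (μ (cyl (Fin.snoc (pastWord p m) a))).toReal / (μ (cyl (pastWord p m))).toReal)
        atTop (nhds (ν p a))) ∧
    ∃ γ : ℕ → ℝ, Summable γ ∧
      ∀ m : ℕ, 1 ≤ m → ∀ p q, IsPast E p → IsPast E q → (∀ i < m, p i = q i) →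
        ∀ a, (p 0, a) ∈ E → |ν p a / ν q a - 1| ≤ γ m

/-- A shift-invariant probability measure carried by the TMC of `E`, positive on allowed
cylinders. -/
def GoodMeasure {A : Type*} [MeasurableSpace A] (E : Set (A × A)) (μ : Measure (ℤ → A)) : Prop :=
  IsProbabilityMeasure μ ∧ Measure.map shiftMap μ = μ ∧ μ (TMC E) = 1 ∧
  ∀ (m : ℕ) (w : Fin m → A), WordIn (TMC E) w → 0 < μ (cyl w)

/-- The identification of `𝔽 × Σ_n` with `𝔥(𝔽,τ,n)`. -/
def ident {F : Type*} (τ : Equiv.Perm F) {n : ℕ} (f : F) (y : ℤ → Fin n) : ℤ → F × Fin n :=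
  fun i => ((τ ^ i) f, y i)

/-- A quasigroup operation on an alphabet. -/
def QuasigroupPointOp {K : Type*} (o : K → K → K) : Prop :=
  ∀ a, Function.Bijective (fun x => o x a) ∧ Function.Bijective (o a)

/-- The data witnessing that an SC bipermutative c.a. is regular and simple. -/
def RegularSimpleData {K F : Type*} (EK : Set (K × K)) (φK : K → K → K)
    (τ : Equiv.Perm F) (n k : ℕ)
    (op : (ℤ → F × Fin n) → (ℤ → F × Fin n) → (ℤ → F × Fin n))
    (θ : K → F × Fin n) (oF : F → F → F) (oS : Fin n → Fin n → Fin n) : Prop :=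
  1 ≤ n ∧ 1 ≤ k ∧
  KBlockOp (hTMC τ n) k op ∧ QuasigroupOp (hTMC τ n) op ∧
  OneBlockConjugacy (TMC EK) (CA φK) (hTMC τ n) (fun x => op x (shiftMap x)) θ ∧
  QuasigroupPointOp oF ∧ QuasigroupPointOp oS ∧
  ∀ (f g : F) (y z : ℤ → Fin n),
    op (ident τ f y) (ident τ g z) = ident τ (oF f g) (fun i => oS (y i) (z i))

/-- An SC bipermutative c.a. is regular and simple. -/
def RegularSimple {K : Type*} (EK : Set (K × K)) (φK : K → K → K) : Prop :=
  ∃ (F : Type) (_ : Fintype F) (τ : Equiv.Perm F) (n k : ℕ)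
    (op : (ℤ → F × Fin n) → (ℤ → F × Fin n) → (ℤ → F × Fin n))
    (θ : K → F × Fin n) (oF : F → F → F) (oS : Fin n → Fin n → Fin n),
    RegularSimpleData EK φK τ n k op θ oF oS

/-- Weak-* convergence of the Cesàro means of `μ` under `Φ` to `κ`. -/
def CesaroTendstoTo {G : Type*} [TopologicalSpace G] [MeasurableSpace G]
    (μ : Measure (ℤ → G)) (Φ : (ℤ → G) → (ℤ → G)) (κ : Measure (ℤ → G)) : Prop :=
  ∀ f : C(ℤ → G, ℝ), Tendsto
    (fun N : ℕ => (N : ℝ)⁻¹ * ∑ n ∈ Finset.range N, ∫ x, f (Φ^[n] x) ∂μ)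
    atTop (nhds (∫ x, f x ∂κ))

/-- `κ` is the Parry measure of the irreducible TMC of `E`. -/
def IsParryMeasure {G : Type*} [Fintype G] [MeasurableSpace G] (E : Set (G × G))
    (κ : Measure (ℤ → G)) : Prop :=
  IsProbabilityMeasure κ ∧ Measure.map shiftMap κ = κ ∧
  ∃ (lam : ℝ) (r l : G → ℝ), 0 < lam ∧ (∀ a, 0 < r a) ∧ (∀ a, 0 < l a) ∧
    (∀ a : G, (∑ b : G, E.indicator (fun _ => r b) (a, b)) = lam * r a) ∧
    (∀ b : G, (∑ a : G, E.indicator (fun _ => l a) (a, b)) = lam * l b) ∧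
    (∑ a : G, l a * r a) = 1 ∧
    ∀ (m : ℕ) (w : Fin (m + 1) → G), WordIn (TMC E) w →
      (κ (cyl w)).toReal = l (w 0) * r (w (Fin.last m)) / lam ^ m

/-- Entropy of the refinement `P ∨ T⁻¹P ∨ ⋯ ∨ T^{-(n-1)}P`. -/
noncomputable def joinEntropy {X : Type*} [MeasurableSpace X] (μ : Measure X) (T : X → X)
    {r : ℕ} (P : Fin r → Set X) (n : ℕ) : ℝ :=
  -∑ c : Fin n → Fin r,
      ((μ (⋂ i : Fin n, T^[(i : ℕ)] ⁻¹' P (c i))).toReal *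
        Real.log (μ (⋂ i : Fin n, T^[(i : ℕ)] ⁻¹' P (c i))).toReal)

/-- The Kolmogorov–Sinai entropy `h_μ(T)` is positive: some finite measurable partition has
positive entropy. -/
def KSEntropyPos {X : Type*} [MeasurableSpace X] (μ : Measure X) (T : X → X) : Prop :=
  ∃ (r : ℕ) (P : Fin r → Set X), (∀ i, MeasurableSet (P i)) ∧
    Pairwise (Function.onFun Disjoint P) ∧ (⋃ i, P i) = Set.univ ∧
    0 < Filter.liminf (fun n : ℕ => joinEntropy μ T P n / n) Filter.atTop

end CAStmt

namespace CAStmt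

section Combinatorics

variable {G : Type*} {E : Set (G × G)} {φ : G → G → G}

lemma exists_point_of_edge (hE : EveryLetterOccurs E) {a b : G} (hab : (a, b) ∈ E) :
    ∃ x ∈ TMC E, x 0 = a ∧ x 1 = b := by
  obtain ⟨x, hx, i, rfl⟩ := hE a
  obtain ⟨y, hy, j, rfl⟩ := hE b
  refine ⟨fun n => if n ≤ 0 then x (i + n) else y (j + n - 1), fun n => ?_, by simp, by simp⟩
  rcases lt_trichotomy n 0 with h | rfl | h
  · have := hx (i + n)
    simpa [h.le, show n + 1 ≤ 0 by omega, add_assoc] using this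
  · simpa using hab
  · have := hy (j + n - 1)
    simpa [show ¬ n ≤ 0 by omega, show ¬ n + 1 ≤ 0 by omega,
      show j + (n + 1) - 1 = j + n - 1 + 1 by ring] using this

lemma exists_pred (hE : EveryLetterOccurs E) (g : G) : ∃ h, (h, g) ∈ E := by
  obtain ⟨x, hx, i, rfl⟩ := hE g
  exact ⟨x (i - 1), by simpa using hx (i - 1)⟩

lemma exists_succ (hE : EveryLetterOccurs E) (g : G) : ∃ h, (g, h) ∈ E := by
  obtain ⟨x, hx, i, rfl⟩ := hE g
  exact ⟨x (i + 1), hx i⟩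

lemma edge_mul (hE : EveryLetterOccurs E) (hSC : SC E φ) {a b c d : G} (hab : (a, b) ∈ E)
    (hcd : (c, d) ∈ E) : (φ a c, φ b d) ∈ E := by
  obtain ⟨x, hx, rfl, rfl⟩ := exists_point_of_edge hE hab
  obtain ⟨y, hy, rfl, rfl⟩ := exists_point_of_edge hE hcd
  simpa using hSC x hx y hy 0

lemma edge_left_div [Finite G] (hE : EveryLetterOccurs E) (hSC : SC E φ) (hR : RightPerm φ)
    {a b c d : G} (hab : (a, b) ∈ E) (hcd : (φ a c, φ b d) ∈ E) : (c, d) ∈ E := by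
  let f : E → E := fun p => ⟨(φ a p.1.1, φ b p.1.2), edge_mul hE hSC hab p.2⟩
  have hf : Function.Injective f := by
    rintro ⟨⟨p, q⟩, h⟩ ⟨⟨p', q'⟩, h'⟩ hh
    simp only [f, Subtype.mk.injEq, Prod.mk.injEq] at hh ⊢
    exact ⟨(hR a).1 hh.1, (hR b).1 hh.2⟩
  obtain ⟨⟨⟨p, q⟩, h⟩, hh⟩ := Finite.surjective_of_injective hf ⟨_, hcd⟩
  simp only [f, Subtype.mk.injEq, Prod.mk.injEq] at hh
  rwa [← (hR a).1 hh.1, ← (hR b).1 hh.2]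

lemma edge_right_div [Finite G] (hE : EveryLetterOccurs E) (hSC : SC E φ) (hL : LeftPerm φ)
    {a b c d : G} (hab : (a, b) ∈ E) (hcd : (φ c a, φ d b) ∈ E) : (c, d) ∈ E := by
  let f : E → E := fun p => ⟨(φ p.1.1 a, φ p.1.2 b), edge_mul hE hSC p.2 hab⟩
  have hf : Function.Injective f := by
    rintro ⟨⟨p, q⟩, h⟩ ⟨⟨p', q'⟩, h'⟩ hh
    simp only [f, Subtype.mk.injEq, Prod.mk.injEq] at hh ⊢
    exact ⟨(hL a).1 hh.1, (hL b).1 hh.2⟩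
  obtain ⟨⟨⟨p, q⟩, h⟩, hh⟩ := Finite.surjective_of_injective hf ⟨_, hcd⟩
  simp only [f, Subtype.mk.injEq, Prod.mk.injEq] at hh
  rwa [← (hL a).1 hh.1, ← (hL b).1 hh.2]

/-- The set of letters that may precede `b`. -/
def preds (E : Set (G × G)) (b : G) : Set G := {a | (a, b) ∈ E}

lemma preds_mul [Finite G] (hE : EveryLetterOccurs E) (hSC : SC E φ) (hL : LeftPerm φ)
    {b y : G} (a : G) (hy : y ∈ preds E b) :
    preds E (φ a b) = (fun x => φ x y) '' preds E a := by
  ext z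
  constructor
  · intro hz
    obtain ⟨c, rfl⟩ := (hL y).2 z
    exact ⟨c, edge_right_div hE hSC hL hy hz, rfl⟩
  · rintro ⟨x, hx, rfl⟩
    exact edge_mul hE hSC hx hy

lemma preds_eq_of_mem [Finite G] (hE : EveryLetterOccurs E) (hSC : SC E φ) (hR : RightPerm φ)
    (hL : LeftPerm φ) {a b y : G} (ha : y ∈ preds E a) (hb : y ∈ preds E b) :
    preds E a = preds E b := by
  obtain ⟨x, hx⟩ := exists_pred hE a
  obtain ⟨y, rfl⟩ := (hR x).2 y
  obtain ⟨c, hc⟩ := (hR a).2 a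
  obtain ⟨d, hd⟩ := (hR a).2 b
  have hyc : y ∈ preds E c := edge_left_div hE hSC hR hx (by rw [hc]; exact ha)
  have hyd : y ∈ preds E d := edge_left_div hE hSC hR hx (by rw [hd]; exact hb)
  rw [← hd, preds_mul hE hSC hL a hyd, ← preds_mul hE hSC hL a hyc, hc]

lemma preds_mul_congr [Finite G] (hE : EveryLetterOccurs E) (hSC : SC E φ) (hR : RightPerm φ)
    (hL : LeftPerm φ) {a a' b b' : G} (ha : preds E a = preds E a')
    (hb : preds E b = preds E b') : preds E (φ a b) = preds E (φ a' b') := by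
  obtain ⟨x, hx⟩ := exists_pred hE a
  obtain ⟨y, hy⟩ := exists_pred hE b
  have hx' : x ∈ preds E a' := ha ▸ hx
  have hy' : y ∈ preds E b' := hb ▸ hy
  exact preds_eq_of_mem hE hSC hR hL (edge_mul hE hSC hx hy) (edge_mul hE hSC hx' hy')

lemma exists_fiber_labelling {Z : Type*} [Finite G] (f : G → Z) {n : ℕ}
    (hn : ∀ g, Nat.card {g' // f g' = f g} = n) :
    ∃ lab : G → Fin n, ∀ g i, ∃ g', f g' = f g ∧ lab g' = i ∧
      ∀ g'', f g'' = f g → lab g'' = i → g'' = g' := by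
  have key : ∀ z : Z, (∃ g, f g = z) → Nonempty ({g' // f g' = z} ≃ Fin n) := by
    rintro _ ⟨g, rfl⟩
    exact ⟨Finite.equivFinOfCardEq (hn g)⟩
  let e : ∀ z : Z, (∃ g, f g = z) → ({g' // f g' = z} ≃ Fin n) := fun z hz => (key z hz).some
  let lab : G → Fin n := fun g => e (f g) ⟨g, rfl⟩ ⟨g, rfl⟩
  have hlab : ∀ g z (h : f g = z), lab g = e z ⟨g, h⟩ ⟨g, h⟩ := by
    rintro g _ rfl
    rfl
  refine ⟨lab, fun g i => ?_⟩
  refine ⟨((e (f g) ⟨g, rfl⟩).symm i).1, ((e (f g) ⟨g, rfl⟩).symm i).2, ?_, ?_⟩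
  · rw [hlab _ (f g) ((e (f g) ⟨g, rfl⟩).symm i).2]
    simp
  · intro g'' h1 h2
    rw [hlab g'' _ h1] at h2
    rw [← h2]
    simp

/-- A letter map `θ` under which an allowed letter of the source is recovered, through `ψ`, from
its image and the image of the next letter. -/
structure IsAmalgamation {B : Type*} (E : Set (G × G)) (E' : Set (B × B)) (θ : G → B)
    (ψ : B → B → G) : Prop where
  surj : Function.Surjective θ
  edge : ∀ {g h}, (g, h) ∈ E → (θ g, θ h) ∈ E'
  iff : ∀ {g h α}, (α, θ h) ∈ E' → (θ g = α ∧ (g, h) ∈ E ↔ g = ψ α (θ h))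

lemma fiber_card_le [Finite G] (hE : EveryLetterOccurs E) (hSC : SC E φ) (hR : RightPerm φ)
    (hL : LeftPerm φ) {g h s t : G} (hgh : (g, h) ∈ E) (hst : (s, t) ∈ E) :
    Nat.card {g' // preds E g' = preds E g ∧ (g', h) ∈ E} ≤
      Nat.card {g' // preds E g' = preds E s ∧ (g', t) ∈ E} := by
  obtain ⟨c, rfl⟩ := (hR g).2 s
  obtain ⟨d, rfl⟩ := (hR h).2 t
  have hcd := edge_left_div hE hSC hR hgh hst
  refine Nat.card_le_card_of_injective
    (fun p => ⟨φ p.1 c, preds_mul_congr hE hSC hR hL p.2.1 rfl, edge_mul hE hSC p.2.2 hcd⟩) ?_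
  rintro ⟨p, hp⟩ ⟨p', hp'⟩ hh
  simp only [Subtype.mk.injEq] at hh ⊢
  exact (hL c).1 hh

/-- One step of the recoding: letters are replaced by their predecessor set together with a label. -/
lemma exists_amalgamation {G : Type} {E : Set (G × G)} {φ : G → G → G} [Fintype G] [Nonempty G]
    (hE : EveryLetterOccurs E) (hSC : SC E φ)
    (hR : RightPerm φ) (hL : LeftPerm φ) :
    ∃ (A : Type) (_ : Fintype A) (n : ℕ) (D : Set (A × A)) (θ : G → A × Fin n)
      (ψ : A × Fin n → A × Fin n → G) (φ' : A → A → A),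
      1 ≤ n ∧ IsAmalgamation E {p | (p.1.1, p.2.1) ∈ D} θ ψ ∧
      (∀ a b c d, (a, b) ∈ D → (c, d) ∈ D → (φ' a c, φ' b d) ∈ D) ∧
      RightPerm φ' ∧ LeftPerm φ' ∧
      (Function.Injective θ → ∃ τ : Equiv.Perm A, D = {p | p.2 = τ p.1}) := by
  classical
  let A := Set.range (preds E)
  let ρ : G → A := fun g => ⟨preds E g, g, rfl⟩
  have hρs : Function.Surjective ρ := by
    rintro ⟨_, g, rfl⟩
    exact ⟨g, rfl⟩
  have hρ : ∀ {g h}, ρ g = ρ h ↔ preds E g = preds E h := Subtype.mk_eq_mk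
  choose sc hsc using exists_succ hE
  let π : G → A := fun g => ρ (sc g)
  have hedge : ∀ {g h}, (g, h) ∈ E ↔ ρ h = π g := by
    intro g h
    simp only [π, hρ]
    constructor
    · exact fun hgh => preds_eq_of_mem hE hSC hR hL (y := g) hgh (hsc g)
    · intro he
      change g ∈ preds E h
      rw [he]
      exact hsc g
  have hfib : ∀ g, {g' | (ρ g', π g') = (ρ g, π g)} =
      {g' | preds E g' = preds E g ∧ (g', sc g) ∈ E} := by
    intro g
    ext g'
    simp only [Set.mem_ofPred_eq, Prod.mk.injEq, hρ, hedge (h := sc g)]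
    exact and_congr_right fun _ => eq_comm
  let g₀ : G := Classical.arbitrary G
  let n := Nat.card {g' // (ρ g', π g') = (ρ g₀, π g₀)}
  have hn : ∀ g, Nat.card {g' // (ρ g', π g') = (ρ g, π g)} = n := by
    intro g
    have h1 := fun g => congrArg (fun s : Set G => Nat.card s) (hfib g)
    refine (h1 g).trans (Eq.trans ?_ (h1 g₀).symm)
    exact le_antisymm (fiber_card_le hE hSC hR hL (hsc _) (hsc _))
      (fiber_card_le hE hSC hR hL (hsc _) (hsc _))
  have hn1 : 1 ≤ n := by
    have : Nonempty {g' // (ρ g', π g') = (ρ g₀, π g₀)} := ⟨⟨g₀, rfl⟩⟩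
    exact Nat.card_pos
  obtain ⟨lab, hlab⟩ := exists_fiber_labelling (fun g => (ρ g, π g)) hn
  let D : Set (A × A) := Set.range fun g => (ρ g, π g)
  let θ : G → A × Fin n := fun g => (ρ g, lab g)
  have hex : ∀ α β : A × Fin n, ∃ g, (α.1, β.1) ∈ D → ∀ g', θ g' = α ∧ π g' = β.1 ↔ g' = g := by
    intro α β
    by_cases hD : (α.1, β.1) ∈ D
    · obtain ⟨g, hg⟩ := hD
      obtain ⟨g', h1, h2, h3⟩ := hlab g α.2
      simp only [Prod.mk.injEq] at hg h1 h3
      refine ⟨g', fun _ g'' => ⟨?_, ?_⟩⟩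
      · rintro ⟨rfl, h5⟩
        exact h3 g'' ⟨by simp [hg, θ], h5.trans hg.2.symm⟩ rfl
      · rintro rfl
        exact ⟨Prod.ext (h1.1.trans hg.1) h2, h1.2.trans hg.2⟩
    · exact ⟨g₀, fun h => absurd h hD⟩
  choose ψ hψ using hex
  have hmul : ∀ {a a' b b'}, ρ a = ρ a' → ρ b = ρ b' → ρ (φ a b) = ρ (φ a' b') := by
    intro a a' b b' ha hb
    rw [hρ] at *
    exact preds_mul_congr hE hSC hR hL ha hb
  choose σ hσ using hρs
  refine ⟨A, inferInstance, n, D, θ, ψ, fun a b => ρ (φ (σ a) (σ b)), hn1, ⟨?_, ?_, ?_⟩, ?_, ?_,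
    ?_, ?_⟩
  · rintro ⟨a, i⟩
    obtain ⟨g, h1, h2, -⟩ := hlab (σ a) i
    simp only [Prod.mk.injEq] at h1
    exact ⟨g, Prod.ext (h1.1.trans (hσ a)) h2⟩
  · intro g h hgh
    exact ⟨g, by simp [θ, hedge.1 hgh]⟩
  · intro g h α hα
    rw [← hψ α (θ h) hα g, hedge, eq_comm (a := ρ h)]
  · rintro a b c d ⟨g, hg⟩ ⟨h, hh⟩
    simp only [Prod.mk.injEq] at hg hh
    obtain ⟨rfl, rfl⟩ := hg
    obtain ⟨rfl, rfl⟩ := hh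
    refine ⟨φ g h, ?_⟩
    simp only [Prod.mk.injEq]
    refine ⟨hmul (hσ _).symm (hσ _).symm, ?_⟩
    rw [hmul (hσ (π g)) (hσ (π h)), eq_comm]
    exact hedge.1 (edge_mul hE hSC (hsc g) (hsc h))
  · intro a
    refine Finite.injective_iff_bijective.1 (Finite.injective_iff_surjective.2 fun b => ?_)
    obtain ⟨c, hc⟩ := (hR (σ a)).2 (σ b)
    refine ⟨ρ c, ?_⟩
    change ρ (φ (σ a) (σ (ρ c))) = b
    rw [hmul (rfl : ρ (σ a) = _) (hσ (ρ c)), hc, hσ]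
  · intro a
    refine Finite.injective_iff_bijective.1 (Finite.injective_iff_surjective.2 fun b => ?_)
    obtain ⟨c, hc⟩ := (hL (σ a)).2 (σ b)
    refine ⟨ρ c, ?_⟩
    change ρ (φ (σ (ρ c)) (σ a)) = b
    rw [hmul (hσ (ρ c)) (rfl : ρ (σ a) = _)]
    exact (congrArg ρ hc).trans (hσ b)
  · intro hinj
    have hπ : ∀ {g g'}, ρ g = ρ g' → π g = π g' := by
      intro g g' h
      obtain ⟨g'', h1, h2, -⟩ := hlab g' (lab g)
      simp only [Prod.mk.injEq] at h1
      have : g'' = g := hinj (Prod.ext (h1.1.trans h.symm) h2)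
      rw [← h1.2, this]
    have hbij : Function.Bijective fun a => π (σ a) := by
      refine Finite.injective_iff_bijective.1 (Finite.injective_iff_surjective.2 fun b => ?_)
      obtain ⟨g, hg⟩ := exists_pred hE (σ b)
      refine ⟨ρ g, ?_⟩
      rw [hπ (hσ (ρ g)), ← hedge.1 hg, hσ]
    refine ⟨Equiv.ofBijective _ hbij, ?_⟩
    ext ⟨a, b⟩
    simp only [D, Set.mem_range, Prod.mk.injEq, Set.mem_ofPred_eq, Equiv.ofBijective_apply]
    constructor
    · rintro ⟨g, rfl, rfl⟩
      exact hπ (hσ (ρ g)).symm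
    · rintro rfl
      exact ⟨σ a, hσ a, rfl⟩

end Combinatorics

section Codes

variable {A B C : Type*} {E : Set (A × A)} {E' : Set (B × B)} {E'' : Set (C × C)}

/-- The letter map `θ` induces a bijection between the two Markov chains, whose inverse is a block
code with memory `0` and anticipation `k - 1`. -/
structure IsCode (E : Set (A × A)) (E' : Set (B × B)) (k : ℕ) (θ : A → B) : Prop where
  edge : ∀ {g h}, (g, h) ∈ E → (θ g, θ h) ∈ E'
  surj : ∀ y ∈ TMC E', ∃ x ∈ TMC E, ∀ i, θ (x i) = y i
  det : ∀ x ∈ TMC E, ∀ x' ∈ TMC E, ∀ j : ℤ,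
    (∀ i : ℕ, i < k → θ (x (j + i)) = θ (x' (j + i))) → x j = x' j

lemma IsCode.mapsTo {k : ℕ} {θ : A → B} (h : IsCode E E' k θ) {x : ℤ → A} (hx : x ∈ TMC E) :
    θ ∘ x ∈ TMC E' := fun i => h.edge (hx i)

lemma IsCode.injOn {k : ℕ} {θ : A → B} (h : IsCode E E' k θ) :
    Set.InjOn (fun x : ℤ → A => θ ∘ x) (TMC E) := fun x hx x' hx' hxx' =>
  funext fun j => h.det x hx x' hx' j fun i _ => congrFun hxx' (j + i)

lemma IsCode.bijOn {k : ℕ} {θ : A → B} (h : IsCode E E' k θ) :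
    Set.BijOn (fun x : ℤ → A => θ ∘ x) (TMC E) (TMC E') := by
  refine ⟨fun x hx => h.mapsTo hx, h.injOn, fun y hy => ?_⟩
  obtain ⟨x, hx, hxy⟩ := h.surj y hy
  exact ⟨x, hx, funext hxy⟩

lemma IsCode.comp {k : ℕ} {θ : A → B} {θ' : B → C} (h : IsCode E E' 2 θ)
    (h' : IsCode E' E'' k θ') : IsCode E E'' (k + 1) (θ' ∘ θ) where
  edge hg := h'.edge (h.edge hg)
  surj z hz := by
    obtain ⟨y, hy, hyz⟩ := h'.surj z hz
    obtain ⟨x, hx, hxy⟩ := h.surj y hy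
    exact ⟨x, hx, fun i => by simp [hxy, hyz]⟩
  det x hx x' hx' j hj := by
    refine h.det x hx x' hx' j fun i hi => ?_
    refine h'.det _ (h.mapsTo hx) _ (h.mapsTo hx') (j + i) fun l hl => ?_
    have := hj (i + l) (by omega)
    simpa [add_assoc] using this

lemma IsAmalgamation.apply_eq {θ : A → B} {ψ : B → B → A} (h : IsAmalgamation E E' θ ψ) {α β : B}
    (hαβ : (α, β) ∈ E') : θ (ψ α β) = α := by
  obtain ⟨b, rfl⟩ := h.surj β
  exact ((h.iff hαβ).2 rfl).1

lemma IsAmalgamation.edge_of {θ : A → B} {ψ : B → B → A} (h : IsAmalgamation E E' θ ψ) {α : B}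
    {b : A} (hαβ : (α, θ b) ∈ E') : (ψ α (θ b), b) ∈ E := ((h.iff hαβ).2 rfl).2

lemma IsAmalgamation.eq_of_edge {θ : A → B} {ψ : B → B → A} (h : IsAmalgamation E E' θ ψ)
    {a b : A} (hab : (a, b) ∈ E) : a = ψ (θ a) (θ b) := (h.iff (h.edge hab)).1 ⟨rfl, hab⟩

lemma IsAmalgamation.isCode {θ : A → B} {ψ : B → B → A} (h : IsAmalgamation E E' θ ψ) :
    IsCode E E' 2 θ where
  edge := h.edge
  surj y hy := by
    refine ⟨fun i => ψ (y i) (y (i + 1)), fun i => ?_, fun i => h.apply_eq (hy i)⟩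
    have h1 := h.apply_eq (hy (i + 1))
    have := h.edge_of (α := y i) (b := ψ (y (i + 1)) (y (i + 1 + 1))) (by rw [h1]; exact hy i)
    rwa [h1] at this
  det x hx x' hx' j hj := by
    have h0 := hj 0 (by norm_num)
    have h1 := hj 1 (by norm_num)
    simp only [Nat.cast_zero, add_zero, Nat.cast_one] at h0 h1
    rw [h.eq_of_edge (hx j), h.eq_of_edge (hx' j), h0, h1]

/-- The past obtained by appending the letter `a` to the past `p`. -/
def consPast (a : A) (p : ℕ → A) : ℕ → A
  | 0 => a
  | i + 1 => p i

lemma snoc_pastWord (p : ℕ → A) (m : ℕ) (a : A) :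
    (Fin.snoc (pastWord p m) a : Fin (m + 1) → A) = pastWord (consPast a p) (m + 1) := by
  ext i
  refine Fin.lastCases ?_ (fun j => ?_) i
  · simp [pastWord, consPast]
  · have : m + 1 - 1 - (j : ℕ) = (m - 1 - j) + 1 := by omega
    simp only [Fin.snoc_castSucc, pastWord, Fin.val_castSucc, this, consPast]

lemma mem_cyl_pastWord {p : ℕ → A} {m : ℕ} {x : ℤ → A} :
    x ∈ cyl (pastWord p m) ↔ ∀ i < m, x ((m : ℤ) - 1 - i) = p i := by
  constructor
  · intro h i hi
    have := h ⟨m - 1 - i, by omega⟩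
    simp only [pastWord] at this
    rw [show m - 1 - (m - 1 - i) = i by omega] at this
    rw [← this]
    congr 1
    omega
  · rintro h ⟨i, hi⟩
    simp only [pastWord]
    rw [← h (m - 1 - i) (by omega)]
    congr 1
    omega

lemma mem_cyl_consPast {p : ℕ → A} {a : A} {m : ℕ} {x : ℤ → A} :
    x ∈ cyl (pastWord (consPast a p) (m + 1)) ↔
      x m = a ∧ ∀ i < m, x ((m : ℤ) - 1 - i) = p i := by
  rw [mem_cyl_pastWord]
  constructor
  · intro h
    refine ⟨by simpa [consPast] using h 0 (by omega), fun i hi => ?_⟩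
    rw [show (m : ℤ) - 1 - i = ((m + 1 : ℕ) : ℤ) - 1 - (i + 1 : ℕ) by push_cast; ring]
    exact h (i + 1) (by omega)
  · rintro ⟨h0, h⟩ (_ | i) hi
    · simpa [consPast] using h0
    · rw [show ((m + 1 : ℕ) : ℤ) - 1 - (i + 1 : ℕ) = (m : ℤ) - 1 - i by push_cast; ring]
      exact h i (by omega)

lemma IsPast.cons {p : ℕ → A} (hp : IsPast E p) {a : A} (ha : (p 0, a) ∈ E) :
    IsPast E (consPast a p) := by
  rintro (_ | i)
  · exact ha
  · exact hp i

/-- The past of the source determined by the past `q` of the target. -/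
def liftPast (ψ : B → B → A) (q : ℕ → B) : ℕ → A := fun i => ψ (q (i + 1)) (q i)

lemma liftPast_cons (ψ : B → B → A) (q : ℕ → B) (b : B) :
    liftPast ψ (consPast b q) = consPast (ψ (q 0) b) (liftPast ψ q) := by
  ext (_ | i) <;> rfl

lemma IsAmalgamation.edge_liftPast {θ : A → B} {ψ : B → B → A} (h : IsAmalgamation E E' θ ψ)
    {q : ℕ → B} (hq : IsPast E' q) {u : A} (hu : θ u = q 0) : (liftPast ψ q 0, u) ∈ E := by
  have := h.edge_of (α := q 1) (b := u) (by rw [hu]; exact hq 0)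
  rwa [hu] at this

lemma IsAmalgamation.isPast_liftPast {θ : A → B} {ψ : B → B → A} (h : IsAmalgamation E E' θ ψ)
    {q : ℕ → B} (hq : IsPast E' q) : IsPast E (liftPast ψ q) := by
  intro i
  have h1 : θ (liftPast ψ q i) = q (i + 1) := h.apply_eq (hq i)
  have := h.edge_of (α := q (i + 2)) (b := liftPast ψ q i) (by rw [h1]; exact hq (i + 1))
  rwa [h1] at this

/-- A uniform multiplicative form of the decay condition, including agreement on no coordinate. -/
lemma exists_uniform_decay [Fintype A] {ν : (ℕ → A) → A → ℝ}
    (hpos : ∀ p, IsPast E p → ∀ a, (p 0, a) ∈ E → 0 < ν p a) {γ : ℕ → ℝ} (hγ : Summable γ)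
    (hdec : ∀ m : ℕ, 1 ≤ m → ∀ p q, IsPast E p → IsPast E q → (∀ i < m, p i = q i) →
        ∀ a, (p 0, a) ∈ E → |ν p a / ν q a - 1| ≤ γ m) :
    ∃ g : ℕ → ℝ, (∀ m, 0 ≤ g m) ∧ Summable g ∧
      ∀ m p q, IsPast E p → IsPast E q → (∀ i < m, p i = q i) →
        ∀ a, (p 0, a) ∈ E → (q 0, a) ∈ E → ν p a ≤ (1 + g m) * ν q a := by
  have hle : ∀ m : ℕ, 1 ≤ m → ∀ p q, IsPast E p → IsPast E q → (∀ i < m, p i = q i) →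
      ∀ a, (p 0, a) ∈ E → ν p a ≤ (1 + |γ m|) * ν q a := by
    intro m hm p q hp hq hpq a ha
    have h1 := (abs_le.1 ((hdec m hm p q hp hq hpq a ha).trans (le_abs_self _))).2
    have hqa : 0 < ν q a := hpos q hq a (hpq 0 (by omega) ▸ ha)
    rw [← div_le_iff₀ hqa]
    linarith
  have hloc : ∀ e : A × A, ∃ c : ℝ, 0 ≤ c ∧ ∀ p, IsPast E p → (p 0, e.2) ∈ E → p 0 = e.1 →
      ν p e.2 ≤ c ∧ 1 ≤ c * ν p e.2 := by
    rintro ⟨b, a⟩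
    by_cases hr : ∃ r, IsPast E r ∧ (r 0, a) ∈ E ∧ r 0 = b
    · obtain ⟨r, hr, hra, rfl⟩ := hr
      have hr0 := hpos r hr a hra
      have hg : 0 ≤ |γ 1| := abs_nonneg _
      refine ⟨(1 + |γ 1|) * ν r a + (1 + |γ 1|) / ν r a, by positivity, fun p hp hpa hpr => ?_⟩
      have hp0 := hpos p hp a hpa
      have h1 := hle 1 le_rfl p r hp hr (fun i hi => by simpa [Nat.lt_one_iff.1 hi] using hpr) a hpa
      have h2 := hle 1 le_rfl r p hr hp
        (fun i hi => by simpa [Nat.lt_one_iff.1 hi] using hpr.symm) a hra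
      refine ⟨h1.trans (le_add_of_nonneg_right (by positivity)), ?_⟩
      calc 1 ≤ (1 + |γ 1|) / ν r a * ν p a := by
            rw [div_mul_eq_mul_div, one_le_div hr0]
            exact h2
        _ ≤ _ := by
            gcongr
            exact le_add_of_nonneg_left (by positivity)
    · exact ⟨0, le_rfl, fun p hp hpa hpr => absurd ⟨p, hp, hpa, hpr⟩ hr⟩
  choose c hc0 hc using hloc
  let T := ∑ e, c e
  have hcT : ∀ e, c e ≤ T := fun e =>
    Finset.single_le_sum (f := c) (fun e _ => hc0 e) (Finset.mem_univ e)
  have hT0 : 0 ≤ T := Finset.sum_nonneg fun e _ => hc0 e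
  refine ⟨fun m => |γ m| + if m = 0 then T * T else 0, fun m => ?_, ?_, fun m p q hp hq hpq a ha hqa
    => ?_⟩
  · dsimp only
    split_ifs <;> positivity
  · refine hγ.abs.add (summable_of_ne_finset_zero (s := {0}) fun m hm => ?_)
    simp at hm
    simp [hm]
  · have hq0 := hpos q hq a hqa
    rcases Nat.eq_zero_or_pos m with rfl | hm
    · have h1 := (hc (p 0, a) p hp ha rfl).1.trans (hcT _)
      have h2 : 1 ≤ T * ν q a := (hc (q 0, a) q hq hqa rfl).2.trans (by gcongr; exact hcT _)
      have h3 : 0 ≤ |γ 0| := abs_nonneg _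
      simp only [if_true]
      nlinarith [mul_nonneg h3 hq0.le, mul_le_mul_of_nonneg_left h2 hT0]
    · simpa [hm.ne'] using hle m hm p q hp hq hpq a ha

end Codes

lemma abs_div_sub_one_le {x y s : ℝ} (hx : 0 < x) (hy : 0 < y) (hxy : x ≤ s * y)
    (hyx : y ≤ s * x) : |x / y - 1| ≤ s - 1 := by
  have hs : 0 < s := pos_of_mul_pos_left (hx.trans_le hxy) hy.le
  have h1 : x / y ≤ s := (div_le_iff₀ hy).2 hxy
  have h2 : 1 / s ≤ x / y := by
    rw [div_le_div_iff₀ hs hy]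
    linarith
  have h3 : 2 - s ≤ 1 / s := by
    rw [le_div_iff₀ hs]
    nlinarith [sq_nonneg (s - 1)]
  rw [abs_le]
  constructor <;> linarith

lemma summable_decay_product {g : ℕ → ℝ} (hg : ∀ m, 0 ≤ g m) (hs : Summable g) :
    Summable fun m => (1 + g (m - 1)) ^ 2 * (1 + g m) - 1 := by
  rw [← summable_nat_add_iff 1]
  simp only [Nat.add_sub_cancel]
  have hT : ∀ m, g m ≤ ∑' m, g m := fun m => hs.le_tsum m fun i _ => hg i
  set T := ∑' m, g m
  refine Summable.of_nonneg_of_le (fun m => ?_) (fun m => ?_)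
    ((hs.mul_left (2 + T)).add (((summable_nat_add_iff 1).2 hs).mul_left ((1 + T) ^ 2)))
  · have h1 := hg m
    have h2 := hg (m + 1)
    nlinarith [mul_nonneg h1 h2, mul_nonneg h1 h1, mul_nonneg (mul_nonneg h1 h1) h2]
  · have h1 := hg m
    have h2 := hg (m + 1)
    have h3 := hT m
    have h4 : (1 + g m) ^ 2 ≤ (1 + T) ^ 2 := by gcongr
    nlinarith [mul_le_mul_of_nonneg_right h4 h2, mul_le_mul_of_nonneg_right h3 h1]

section Measures

variable {A B : Type*} [MeasurableSpace A] [MeasurableSpace B]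

lemma measurable_shiftMap : Measurable (shiftMap : (ℤ → A) → ℤ → A) :=
  measurable_pi_iff.2 fun i => measurable_pi_apply (i + 1)

lemma measurable_comp_letters [Finite A] [MeasurableSingletonClass A] (θ : A → B) :
    Measurable (fun x : ℤ → A => θ ∘ x) :=
  measurable_pi_iff.2 fun i => (measurable_of_finite θ).comp (measurable_pi_apply i)

lemma measurableSet_TMC [Finite A] [MeasurableSingletonClass A] (E : Set (A × A)) :
    MeasurableSet (TMC E) := by
  have : TMC E = ⋂ i : ℤ, (fun x : ℤ → A => (x i, x (i + 1))) ⁻¹' E := by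
    ext x
    simp [TMC]
  rw [this]
  exact MeasurableSet.iInter fun i =>
    ((measurable_pi_apply i).prodMk (measurable_pi_apply (i + 1))) E.toFinite.measurableSet

lemma measurableSet_cyl [MeasurableSingletonClass A] {m : ℕ} (w : Fin m → A) :
    MeasurableSet (cyl w) := by
  have : cyl w = ⋂ i : Fin m, (fun x : ℤ → A => x ((i : ℕ) : ℤ)) ⁻¹' {w i} := by
    ext x
    simp [cyl]
  rw [this]
  exact MeasurableSet.iInter fun i => measurable_pi_apply _ (measurableSet_singleton _)

lemma GoodMeasure.map [Finite A] [MeasurableSingletonClass A] {E : Set (A × A)} {E' : Set (B × B)}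
    {k : ℕ} {θ : A → B} (h : IsCode E E' k θ) {μ : Measure (ℤ → A)} (hμ : GoodMeasure E μ) :
    GoodMeasure E' (Measure.map (fun x => θ ∘ x) μ) := by
  obtain ⟨h1, h2, h3, h4⟩ := hμ
  have hθ := measurable_comp_letters (B := B) θ
  have hP := Measure.isProbabilityMeasure_map (μ := μ) hθ.aemeasurable
  refine ⟨hP, ?_, ?_, fun m w hw => ?_⟩
  · rw [Measure.map_map measurable_shiftMap hθ]
    conv_rhs => rw [← h2, Measure.map_map hθ measurable_shiftMap]
    rfl
  · refine le_antisymm prob_le_one ?_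
    rw [← h3]
    exact (measure_mono fun x hx => h.mapsTo hx).trans (Measure.le_map_apply hθ.aemeasurable _)
  · obtain ⟨y, hy, j, hj⟩ := hw
    obtain ⟨x, hx, hxy⟩ := h.surj y hy
    refine (h4 m (fun i => x (j + ((i : ℕ) : ℤ))) ⟨x, hx, j, fun _ => rfl⟩).trans_le ?_
    refine (measure_mono fun z hz i => ?_).trans (Measure.le_map_apply hθ.aemeasurable _)
    change θ (z _) = _
    rw [hz i, hxy, hj]

variable {E : Set (A × A)} {E' : Set (B × B)} {θ : A → B} {ψ : B → B → A}

open scoped Classical in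
lemma IsAmalgamation.map_cyl [Fintype A] [MeasurableSingletonClass A] [MeasurableSingletonClass B]
    (h : IsAmalgamation E E' θ ψ) {μ : Measure (ℤ → A)} [IsProbabilityMeasure μ]
    (hμ : μ (TMC E) = 1) {q : ℕ → B} (hq : IsPast E' q) (m : ℕ) :
    (Measure.map (fun x => θ ∘ x) μ (cyl (pastWord q (m + 1)))).toReal =
      ∑ u with θ u = q 0, (μ (cyl (pastWord (consPast u (liftPast ψ q)) (m + 1)))).toReal := by
  have hθ := measurable_comp_letters (B := B) θ
  have hae : ∀ᵐ x ∂μ, x ∈ TMC E := by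
    rw [ae_iff]
    exact (prob_compl_eq_zero_iff (measurableSet_TMC E)).2 hμ
  rw [Measure.map_apply hθ (measurableSet_cyl _)]
  have hset : (fun x : ℤ → A => θ ∘ x) ⁻¹' cyl (pastWord q (m + 1)) =ᵐ[μ]
      ⋃ u ∈ Finset.univ.filter fun u => θ u = q 0,
        cyl (pastWord (consPast u (liftPast ψ q)) (m + 1)) := by
    filter_upwards [hae] with x hx
    refine propext ?_
    change θ ∘ x ∈ cyl (pastWord q (m + 1)) ↔ x ∈ ⋃ u ∈ Finset.univ.filter fun u => θ u = q 0,
        cyl (pastWord (consPast u (liftPast ψ q)) (m + 1))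
    rw [mem_cyl_pastWord]
    simp only [Set.mem_iUnion, Finset.mem_filter, Finset.mem_univ, true_and, exists_prop,
      mem_cyl_consPast, Function.comp_apply]
    constructor
    · intro hxq
      refine ⟨x m, by simpa using hxq 0 (by omega), rfl, fun i hi => ?_⟩
      have h1 := hxq i (by omega)
      have h2 := hxq (i + 1) (by omega)
      have h3 := h.eq_of_edge (hx ((m : ℤ) - 1 - i))
      rw [show ((m + 1 : ℕ) : ℤ) - 1 - i = (m : ℤ) - 1 - i + 1 by push_cast; ring] at h1
      rw [show ((m + 1 : ℕ) : ℤ) - 1 - (i + 1 : ℕ) = (m : ℤ) - 1 - i by push_cast; ring] at h2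
      rw [h3, h1, h2]
      rfl
    · rintro ⟨u, hu, rfl, hxP⟩ (_ | i) hi
      · simpa using hu
      · rw [show ((m + 1 : ℕ) : ℤ) - 1 - (i + 1 : ℕ) = (m : ℤ) - 1 - i by push_cast; ring,
          hxP i (by omega)]
        exact h.apply_eq (hq i)
  rw [measure_congr hset, measure_biUnion_finset, ENNReal.toReal_sum]
  · exact fun u _ => measure_ne_top _ _
  · intro u _ v _ huv
    refine Set.disjoint_left.2 fun x hxu hxv => huv ?_
    rw [← (mem_cyl_consPast.1 hxu).1, ← (mem_cyl_consPast.1 hxv).1]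
  · exact fun u _ => measurableSet_cyl _

open scoped Classical in
lemma CCSD.map_amalgamation [Fintype A] [MeasurableSingletonClass A] [MeasurableSingletonClass B]
    (h : IsAmalgamation E E' θ ψ) {μ : Measure (ℤ → A)} [IsProbabilityMeasure μ]
    (hμ : μ (TMC E) = 1) (hc : CCSD E μ) : CCSD E' (Measure.map (fun x => θ ∘ x) μ) := by
  obtain ⟨ν, hν, γ, hγ, hdec⟩ := hc
  obtain ⟨g, hg0, hg, hle⟩ := exists_uniform_decay (fun p hp a ha => (hν p hp a ha).1) hγ hdec
  let num : (ℕ → B) → B → ℝ := fun q a =>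
    ∑ b with θ b = a, ν (consPast (ψ (q 0) a) (liftPast ψ q)) b
  let den : (ℕ → B) → ℝ := fun q => ∑ u with θ u = q 0, ν (liftPast ψ q) u
  have hedge : ∀ {q}, IsPast E' q → ∀ {a}, (q 0, a) ∈ E' → (liftPast ψ q 0, ψ (q 0) a) ∈ E :=
    fun hq _ ha => h.edge_liftPast hq (h.apply_eq ha)
  have hcons : ∀ {q}, IsPast E' q → ∀ {a}, (q 0, a) ∈ E' →
      IsPast E (consPast (ψ (q 0) a) (liftPast ψ q)) :=
    fun hq _ ha => (h.isPast_liftPast hq).cons (hedge hq ha)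
  have hedge' : ∀ {α a b}, (α, a) ∈ E' → θ b = a → (ψ α a, b) ∈ E := by
    rintro α _ b ha rfl
    exact h.edge_of ha
  have hfst : ∀ {q}, IsPast E' q → ∀ {a}, (q 0, a) ∈ E' → 0 < ν (liftPast ψ q) (ψ (q 0) a) :=
    fun hq _ ha => (hν _ (h.isPast_liftPast hq) _ (hedge hq ha)).1
  have hnum : ∀ {q}, IsPast E' q → ∀ {a}, (q 0, a) ∈ E' → 0 < num q a := by
    intro q hq a ha
    obtain ⟨b, hb⟩ := h.surj a
    refine Finset.sum_pos (fun b hb => ?_) ⟨b, by simpa using hb⟩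
    exact (hν _ (hcons hq ha) _ (hedge' ha (by simpa using hb))).1
  have hden : ∀ {q}, IsPast E' q → 0 < den q := by
    intro q hq
    obtain ⟨b, hb⟩ := h.surj (q 0)
    refine Finset.sum_pos (fun b hb => ?_) ⟨b, by simpa using hb⟩
    exact (hν _ (h.isPast_liftPast hq) _ (h.edge_liftPast hq (by simpa using hb))).1
  let ν' : (ℕ → B) → B → ℝ := fun q a => ν (liftPast ψ q) (ψ (q 0) a) * num q a / den q
  have hν' : ∀ {q}, IsPast E' q → ∀ {a}, (q 0, a) ∈ E' → 0 < ν' q a :=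
    fun hq _ ha => div_pos (mul_pos (hfst hq ha) (hnum hq ha)) (hden hq)
  refine ⟨ν', fun q hq a ha => ⟨hν' hq ha, ?_⟩, _, summable_decay_product hg0 hg, ?_⟩
  · rw [← tendsto_add_atTop_iff_nat 1]
    let M : (ℕ → A) → ℕ → ℝ := fun p m => (μ (cyl (pastWord p m))).toReal
    have hlim : ∀ p, IsPast E p → ∀ a, (p 0, a) ∈ E →
        Tendsto (fun m => M (consPast a p) (m + 1) / M p m) atTop (nhds (ν p a)) := by
      intro p hp a ha
      simpa only [snoc_pastWord] using (hν p hp a ha).2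
    have hP := h.isPast_liftPast hq
    have h1 := hlim _ hP _ (hedge hq ha)
    have h2 : Tendsto (fun m => ∑ b with θ b = a,
        M (consPast b (consPast (ψ (q 0) a) (liftPast ψ q))) (m + 1 + 1) /
          M (consPast (ψ (q 0) a) (liftPast ψ q)) (m + 1)) atTop (nhds (num q a)) :=
      tendsto_finsetSum _ fun b hb => (tendsto_add_atTop_iff_nat 1).2
        (hlim _ (hcons hq ha) b (hedge' ha (by simpa using hb)))
    have h3 : Tendsto (fun m => ∑ u with θ u = q 0,
        M (consPast u (liftPast ψ q)) (m + 1) / M (liftPast ψ q) m) atTop (nhds (den q)) :=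
      tendsto_finsetSum _ fun u hu => hlim _ hP u (h.edge_liftPast hq (by simpa using hu))
    refine ((h1.mul h2).div h3 (hden hq).ne').congr' ?_
    filter_upwards [h1.eventually_ne (hfst hq ha).ne'] with m hm
    obtain ⟨hm1, hm2⟩ := div_ne_zero_iff.1 hm
    rw [snoc_pastWord, h.map_cyl hμ (hq.cons ha), h.map_cyl hμ hq, liftPast_cons, Pi.div_apply,
      ← Finset.sum_div, ← Finset.sum_div]
    change _ = (∑ b with θ b = a,
        M (consPast b (consPast (ψ (q 0) a) (liftPast ψ q))) (m + 1 + 1)) /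
      ∑ u with θ u = q 0, M (consPast u (liftPast ψ q)) (m + 1)
    field_simp
  · have main : ∀ m : ℕ, 1 ≤ m → ∀ p q, IsPast E' p → IsPast E' q → (∀ i < m, p i = q i) →
        ∀ a, (p 0, a) ∈ E' → ν' p a ≤ (1 + g (m - 1)) ^ 2 * (1 + g m) * ν' q a := by
      intro m hm p q hp hq hpq a hpa
      have h0 : p 0 = q 0 := hpq 0 hm
      have hqa : (q 0, a) ∈ E' := h0 ▸ hpa
      have hlift : ∀ i < m - 1, liftPast ψ p i = liftPast ψ q i := fun i hi => by
        simp only [liftPast, hpq i (by omega), hpq (i + 1) (by omega)]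
      have hP := h.isPast_liftPast hp
      have hQ := h.isPast_liftPast hq
      have e1 : ν (liftPast ψ p) (ψ (p 0) a) ≤
          (1 + g (m - 1)) * ν (liftPast ψ q) (ψ (q 0) a) := by
        rw [h0]
        exact hle _ _ _ hP hQ hlift _ (h0 ▸ hedge hp hpa) (hedge hq hqa)
      have e2 : num p a ≤ (1 + g m) * num q a := by
        rw [Finset.mul_sum]
        refine Finset.sum_le_sum fun b hb => ?_
        have hb : θ b = a := by simpa using hb
        refine hle _ _ _ (hcons hp hpa) (hcons hq hqa) ?_ b (hedge' hpa hb) (hedge' hqa hb)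
        rintro (_ | i) hi
        · simp only [consPast, h0]
        · exact hlift i (by omega)
      have e3 : den q ≤ (1 + g (m - 1)) * den p := by
        simp only [den, h0]
        rw [Finset.mul_sum]
        refine Finset.sum_le_sum fun u hu => ?_
        have hu : θ u = q 0 := by simpa using hu
        exact hle _ _ _ hQ hP (fun i hi => (hlift i hi).symm) u (h.edge_liftPast hq hu)
          (h.edge_liftPast hp (hu.trans h0.symm))
      have g1 := hg0 (m - 1)
      have g2 := hg0 m
      have n1 := hfst hq hqa
      have n2 := hnum hq hqa
      calc ν' p a ≤ ((1 + g (m - 1)) * ν (liftPast ψ q) (ψ (q 0) a)) * ((1 + g m) * num q a) /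
            (den q / (1 + g (m - 1))) := by
            refine div_le_div₀ (by positivity) ?_ (div_pos (hden hq) (by positivity)) ?_
            · exact mul_le_mul e1 e2 (hnum hp hpa).le (by positivity)
            · rw [div_le_iff₀ (by positivity)]
              linarith
        _ = _ := by
            have := (hden hq).ne'
            simp only [ν']
            field_simp
    intro m hm p q hp hq hpq a ha
    have hqa : (q 0, a) ∈ E' := hpq 0 hm ▸ ha
    exact abs_div_sub_one_le (hν' hp ha) (hν' hq hqa) (main m hm p q hp hq hpq a ha)
      (main m hm q p hq hp (fun i hi => (hpq i hi).symm) a hqa)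

end Measures

/-- `θ` transports invariant measures with complete connections and summable decay. -/
def Transfers {A B : Type*} [MeasurableSpace A] [MeasurableSpace B] (E : Set (A × A))
    (E' : Set (B × B)) (θ : A → B) : Prop :=
  ∀ μ : Measure (ℤ → A), GoodMeasure E μ → CCSD E μ →
    GoodMeasure E' (Measure.map (fun x => θ ∘ x) μ) ∧ CCSD E' (Measure.map (fun x => θ ∘ x) μ)

lemma Transfers.comp {A B C : Type*} [MeasurableSpace A] [MeasurableSpace B] [MeasurableSpace C]
    [Finite A] [MeasurableSingletonClass A] [Finite B] [MeasurableSingletonClass B]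
    {E : Set (A × A)} {E' : Set (B × B)} {E'' : Set (C × C)} {θ : A → B} {θ' : B → C}
    (h : Transfers E E' θ) (h' : Transfers E' E'' θ') : Transfers E E'' (θ' ∘ θ) := by
  intro μ hμ hc
  have := h' _ (h μ hμ hc).1 (h μ hμ hc).2
  rwa [Measure.map_map (measurable_comp_letters θ') (measurable_comp_letters θ)] at this

lemma IsAmalgamation.transfers {A B : Type*} [MeasurableSpace A] [MeasurableSpace B] [Finite A]
    [MeasurableSingletonClass A] [MeasurableSingletonClass B] {E : Set (A × A)} {E' : Set (B × B)}
    {θ : A → B} {ψ : B → B → A} (h : IsAmalgamation E E' θ ψ) : Transfers E E' θ := by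
  have := Fintype.ofFinite A
  intro μ hμ hc
  have := hμ.1
  exact ⟨hμ.map h.isCode, hc.map_amalgamation h hμ.2.2.1⟩

/-- Iterated amalgamation recodes the Markov chain as a permutation times a full shift. -/
lemma exists_code (N : ℕ) : ∀ (G : Type) [Fintype G] [Nonempty G] [MeasurableSpace G]
    [MeasurableSingletonClass G] (E : Set (G × G)) (φ : G → G → G), EveryLetterOccurs E →
    SC E φ → RightPerm φ → LeftPerm φ → Fintype.card G = N →
    ∃ (F : Type) (_ : Fintype F) (_ : MeasurableSpace F) (_ : MeasurableSingletonClass F)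
      (τ : Equiv.Perm F) (n k : ℕ) (θ : G → F × Fin n), 1 ≤ n ∧ 1 ≤ k ∧
      IsCode E {p : (F × Fin n) × (F × Fin n) | p.2.1 = τ p.1.1} k θ ∧
      Transfers E {p : (F × Fin n) × (F × Fin n) | p.2.1 = τ p.1.1} θ := by
  induction N using Nat.strong_induction_on with
  | _ N ih =>
  intro G _ _ _ _ E φ hE hSC hR hL hN
  obtain ⟨A, _, n, D, θ, ψ, φ', hn, hθ, hD, hR', hL', hinj⟩ := exists_amalgamation hE hSC hR hL
  let _ : MeasurableSpace A := ⊤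
  have : MeasurableSingletonClass A := ⟨fun _ => trivial⟩
  by_cases hi : Function.Injective θ
  · obtain ⟨τ, rfl⟩ := hinj hi
    exact ⟨A, inferInstance, inferInstance, inferInstance, τ, n, 2, θ, hn, by norm_num,
      hθ.isCode, hθ.transfers⟩
  have : NeZero n := ⟨by omega⟩
  have hcard : Fintype.card (A × Fin n) < N := by
    rw [← hN]
    exact Fintype.card_lt_of_surjective_not_injective θ hθ.surj hi
  have hne : Nonempty (A × Fin n) := ⟨θ (Classical.arbitrary G)⟩
  have hE' : EveryLetterOccurs {p : (A × Fin n) × (A × Fin n) | (p.1.1, p.2.1) ∈ D} := by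
    intro b
    obtain ⟨g, rfl⟩ := hθ.surj b
    obtain ⟨x, hx, i, rfl⟩ := hE g
    exact ⟨θ ∘ x, hθ.isCode.mapsTo hx, i, rfl⟩
  have hSC' : SC {p : (A × Fin n) × (A × Fin n) | (p.1.1, p.2.1) ∈ D}
      (fun p q : A × Fin n => (φ' p.1 q.1, p.2 + q.2)) :=
    fun x hx y hy i => hD _ _ _ _ (hx i) (hy i)
  have hRP : RightPerm (fun p q : A × Fin n => (φ' p.1 q.1, p.2 + q.2)) :=
    fun a => (hR' a.1).prodMap (Equiv.addLeft a.2).bijective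
  have hLP : LeftPerm (fun p q : A × Fin n => (φ' p.1 q.1, p.2 + q.2)) :=
    fun a => (hL' a.1).prodMap (Equiv.addRight a.2).bijective
  obtain ⟨F, i1, i2, i3, τ, n', k, θ', hn', hk, hcode, htr⟩ :=
    ih _ hcard (A × Fin n) _ _ hE' hSC' hRP hLP rfl
  exact ⟨F, i1, i2, i3, τ, n', k + 1, θ' ∘ θ, hn', by omega, hθ.isCode.comp hcode,
    hθ.transfers.comp htr⟩

section Operation

variable {A B : Type*} {E : Set (A × A)} {E' : Set (B × B)} {φ : A → A → A}

/-- The coordinatewise operation `φ` on `TMC E`, transported along the letter map `θ`. -/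
noncomputable def transportOp [Nonempty A] (E : Set (A × A)) (φ : A → A → A) (θ : A → B)
    (x y : ℤ → B) : ℤ → B := fun i =>
  θ (φ (Function.invFunOn (fun z : ℤ → A => θ ∘ z) (TMC E) x i)
    (Function.invFunOn (fun z : ℤ → A => θ ∘ z) (TMC E) y i))

lemma transportOp_comp [Nonempty A] {k : ℕ} {θ : A → B} (h : IsCode E E' k θ) {x y : ℤ → A}
    (hx : x ∈ TMC E) (hy : y ∈ TMC E) :
    transportOp E φ θ (θ ∘ x) (θ ∘ y) = θ ∘ fun i => φ (x i) (y i) := by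
  have hinv := h.injOn.leftInvOn_invFunOn
  have h1 := hinv hx
  have h2 := hinv hy
  simp only at h1 h2
  funext i
  simp only [transportOp, h1, h2, Function.comp_apply]

lemma quasigroupOp_pointwise [Finite A] (hE : EveryLetterOccurs E) (hSC : SC E φ)
    (hR : RightPerm φ) (hL : LeftPerm φ) :
    QuasigroupOp (TMC E) (fun x y i => φ (x i) (y i)) := by
  intro z hz
  refine ⟨⟨fun x hx => hSC x hx z hz, fun x _ y _ h => funext fun i => (hL (z i)).1 (congrFun h i),
    fun y hy => ?_⟩, ⟨fun x hx => hSC z hz x hx,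
    fun x _ y _ h => funext fun i => (hR (z i)).1 (congrFun h i), fun y hy => ?_⟩⟩
  · choose x hx using fun i => (hL (z i)).2 (y i)
    refine ⟨x, fun i => edge_right_div hE hSC hL (hz i) ?_, funext hx⟩
    have := hy i
    rwa [← hx i, ← hx (i + 1)] at this
  · choose x hx using fun i => (hR (z i)).2 (y i)
    refine ⟨x, fun i => edge_left_div hE hSC hR (hz i) ?_, funext hx⟩
    have := hy i
    rwa [← hx i, ← hx (i + 1)] at this

lemma bijOn_of_semiconj {X Y : Type*} {s : Set X} {t : Set Y} {f : X → Y} (hf : Set.BijOn f s t)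
    {u : X → X} {v : Y → Y} (hu : Set.BijOn u s s) (huv : ∀ x ∈ s, v (f x) = f (u x)) :
    Set.BijOn v t t := by
  have h1 : Set.BijOn (v ∘ f) s t := (hf.comp hu).congr fun x hx => (huv x hx).symm
  exact (Set.bijOn_comp_iff hf.injOn).1 h1 |> fun h => hf.image_eq ▸ h

lemma quasigroupOp_transportOp [Finite A] [Nonempty A] {k : ℕ} {θ : A → B} (h : IsCode E E' k θ)
    (hE : EveryLetterOccurs E) (hSC : SC E φ) (hR : RightPerm φ) (hL : LeftPerm φ) :
    QuasigroupOp (TMC E') (transportOp E φ θ) := by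
  intro z hz
  obtain ⟨x, hx, rfl⟩ := h.bijOn.surjOn hz
  have hq := quasigroupOp_pointwise hE hSC hR hL x hx
  exact ⟨bijOn_of_semiconj h.bijOn hq.1 fun y hy => transportOp_comp h hy hx,
    bijOn_of_semiconj h.bijOn hq.2 fun y hy => transportOp_comp h hx hy⟩

lemma kBlockOp_transportOp [Nonempty A] {k : ℕ} {θ : A → B} (h : IsCode E E' k θ)
    (hSC : SC E φ) : KBlockOp (TMC E') k (transportOp E φ θ) := by
  refine ⟨fun u hu v hv => ?_, ?_⟩
  · obtain ⟨x, hx, rfl⟩ := h.bijOn.surjOn hu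
    obtain ⟨y, hy, rfl⟩ := h.bijOn.surjOn hv
    simp only [transportOp_comp h hx hy]
    exact h.mapsTo (hSC x hx y hy)
  · have hdec : ∀ w : Fin k → B, ∃ a : A, ∀ x ∈ TMC E, ∀ j : ℤ,
        (∀ i : Fin k, θ (x (j + ((i : ℕ) : ℤ))) = w i) → x j = a := by
      intro w
      by_cases hw : ∃ x ∈ TMC E, ∃ j : ℤ, ∀ i : Fin k, θ (x (j + ((i : ℕ) : ℤ))) = w i
      · obtain ⟨x, hx, j, hxw⟩ := hw
        refine ⟨x j, fun x' hx' j' hx'w => ?_⟩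
        have hs : (fun l => x (l + (j - j'))) ∈ TMC E := fun l => by
          have := hx (l + (j - j'))
          rwa [show l + (j - j') + 1 = l + 1 + (j - j') by ring] at this
        have := h.det x' hx' _ hs j' fun i hi => by
          rw [hx'w ⟨i, hi⟩, ← hxw ⟨i, hi⟩]
          simp only
          congr 2
          ring
        simpa using this
      · exact ⟨Classical.arbitrary A, fun x hx j hxw => absurd ⟨x, hx, j, hxw⟩ hw⟩
    choose d hd using hdec
    refine ⟨fun u v => θ (φ (d u) (d v)), fun u hu v hv j => ?_⟩
    obtain ⟨x, hx, rfl⟩ := h.bijOn.surjOn hu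
    obtain ⟨y, hy, rfl⟩ := h.bijOn.surjOn hv
    simp only [transportOp_comp h hx hy, Function.comp_apply]
    rw [hd _ x hx j fun i => rfl, hd _ y hy j fun i => rfl]

end Operation

end CAStmt

/-- Proposition: the recodification of an SC bipermutative c.a. can be
chosen so that it preserves complete connections and summable decay. -/
theorem CAStmt.stmt13 {G : Type} [Fintype G] [MeasurableSpace G] [MeasurableSingletonClass G]
    (E : Set (G × G)) (hE : EveryLetterOccurs E)
    (φ : G → G → G) (hSC : SC E φ) (hR : RightPerm φ) (hL : LeftPerm φ)
    (μ : Measure (ℤ → G)) (hgood : GoodMeasure E μ) (hccsd : CCSD E μ) :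
    ∃ (F : Type) (_ : Fintype F) (_ : MeasurableSpace F) (_ : MeasurableSingletonClass F)
      (τ : Equiv.Perm F) (n k : ℕ),
      1 ≤ n ∧ 1 ≤ k ∧
      ∃ (op : (ℤ → F × Fin n) → (ℤ → F × Fin n) → (ℤ → F × Fin n)) (θ : G → F × Fin n),
        KBlockOp (hTMC τ n) k op ∧ QuasigroupOp (hTMC τ n) op ∧
        OneBlockConjugacy (TMC E) (CA φ) (hTMC τ n) (fun x => op x (shiftMap x)) θ ∧
        GoodMeasure {p : (F × Fin n) × (F × Fin n) | p.2.1 = τ p.1.1}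
          (Measure.map (fun x => θ ∘ x) μ) ∧
        CCSD {p : (F × Fin n) × (F × Fin n) | p.2.1 = τ p.1.1}
          (Measure.map (fun x => θ ∘ x) μ) := by
  have hprob := hgood.1
  have : Nonempty G := by
    obtain ⟨x⟩ := nonempty_of_isProbabilityMeasure μ
    exact ⟨x 0⟩
  obtain ⟨F, i1, i2, i3, τ, n, k, θ, hn, hk, hcode, htr⟩ :=
    exists_code _ G E φ hE hSC hR hL rfl
  refine ⟨F, i1, i2, i3, τ, n, k, hn, hk, transportOp E φ θ, θ, kBlockOp_transportOp hcode hSC,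
    quasigroupOp_transportOp hcode hE hSC hR hL, ⟨hcode.bijOn, fun x hx => ?_⟩, htr μ hgood hccsd⟩
  have hs : shiftMap x ∈ TMC E := fun i => hx (i + 1)
  exact (transportOp_comp hcode hx hs).symm
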